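/- Let M be a compact Hausdorff space, ζ a symplectic quasi-state on C(M) with associated quasi-measure τ, and X = Φ^{-1}(p_0) a stem of a Poisson-commutative subspace with moment map Φ, such that the push-forward measure σ of τ under Φ is the Dirac measure at p_0. Then τ(X) = 1. -/

import Mathlib

open MeasureTheory

/-- End of Lemma 3.2: if the push-forward of the quasi-measure of a symplectic
quasi-state under the moment map `Φ` is the Dirac measure at `p₀` (i.e. the
functional `G ↦ ζ (Φ*G)` evaluates compactly supported smooth functions at
`p₀`), then the stem `X = Φ⁻¹(p₀)` has full quasi-measure:
`τ X = inf {ζ F : 0 ≤ F ≤ 1, F ≡ 1 on X} = 1`. -/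
theorem stem_has_full_quasimeasure
    {M : Type*} [TopologicalSpace M] [CompactSpace M] [T2Space M] {N : ℕ}
    (Φ : C(M, Fin N → ℝ)) (p₀ : Fin N → ℝ)
    (ζ : C(M, ℝ) → ℝ)
    (hmono : ∀ F G : C(M, ℝ), F ≤ G → ζ F ≤ ζ G)
    (hnorm : ζ 1 = 1)
    (hdirac : ∀ (G : (Fin N → ℝ) → ℝ) (hG : ContDiff ℝ (⊤ : ℕ∞) G),
      HasCompactSupport G →
      ζ ((⟨G, hG.continuous⟩ : C(Fin N → ℝ, ℝ)).comp Φ) = G p₀) :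
    sInf (ζ '' {F : C(M, ℝ) | 0 ≤ F ∧ F ≤ 1 ∧ ∀ x ∈ (⇑Φ ⁻¹' {p₀}), F x = 1})
      = 1 := by
  refine IsLeast.csInf_eq ⟨⟨1, ⟨zero_le_one, le_rfl, fun _ _ => rfl⟩, hnorm⟩, ?_⟩
  rintro _ ⟨F, ⟨hF0, -, hF1⟩, rfl⟩
  refine le_of_forall_lt fun c hc => ?_
  obtain ⟨a, hca, ha1⟩ := exists_between (max_lt hc one_pos)
  obtain ⟨hca, ha0⟩ := max_lt_iff.mp hca
  refine hca.trans_le ?_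
  have hK : IsClosed (Φ '' {x | F x ≤ a}) :=
    ((isClosed_le F.continuous continuous_const).isCompact.image Φ.continuous).isClosed
  have hp : p₀ ∉ Φ '' {x | F x ≤ a} := by
    rintro ⟨x, hx, hxp⟩
    exact absurd (hx.trans_lt ha1) (by simp [hF1 x hxp])
  obtain ⟨g, hgs, hgc, hg, hgr, hgp⟩ :=
    exists_contDiff_tsupport_subset (n := ⊤) (hK.isOpen_compl.mem_nhds hp)
  have hG : ContDiff ℝ (⊤ : ℕ∞) (fun y => a * g y) := contDiff_const.mul hg
  have key := hdirac _ hG hgc.mul_left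
  rw [hgp, mul_one] at key
  rw [← key]
  refine hmono _ _ fun x => ?_
  change a * g (Φ x) ≤ F x
  have hx1 : g (Φ x) ≤ 1 := (hgr ⟨Φ x, rfl⟩).2
  by_cases hx : F x ≤ a
  · have hgx : g (Φ x) = 0 :=
      image_eq_zero_of_notMem_tsupport fun h => hgs h ⟨x, hx, rfl⟩
    simpa [hgx] using hF0 x
  · exact (mul_le_of_le_one_right ha0.le hx1).trans (not_le.mp hx).le
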